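/- Under the iterative decomposition scheme applied to a centered Gaussian measure γ on a separable Banach space X, with λ_n > 0 for all n: the sequence (λ_n) is non-increasing and λ_n → 0 as n → ∞. -/

import Mathlib

open MeasureTheory ProbabilityTheory

def IsCenteredGaussian {X : Type*} [NormedAddCommGroup X] [NormedSpace ℝ X]
    [MeasurableSpace X] (γ : Measure X) : Prop :=
  IsProbabilityMeasure γ ∧
    ∀ f : X →L[ℝ] ℝ, ∃ v : NNReal, γ.map f = gaussianReal 0 v

open Filter Topology in
/-- If `μ` has a finite second moment, then uniformly bounded functionals converging to `0`
pointwise converge to `0` in `L²(μ)`. -/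
lemma tendsto_integral_sq_of_forall_tendsto_zero {X : Type*} [NormedAddCommGroup X]
    [NormedSpace ℝ X] [MeasurableSpace X] [BorelSpace X] {μ : Measure X}
    (hμ : Integrable (fun x : X ↦ ‖x‖ ^ 2) μ) {g : ℕ → X →L[ℝ] ℝ} {C : ℝ}
    (hC : ∀ k, ‖g k‖ ≤ C) (hg : ∀ x, Tendsto (fun k ↦ g k x) atTop (𝓝 0)) :
    Tendsto (fun k ↦ ∫ x, g k x * g k x ∂μ) atTop (𝓝 0) := by
  have h := tendsto_integral_of_dominated_convergence (μ := μ)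
    (F := fun k x ↦ g k x * g k x) (f := fun _ ↦ 0) (fun x ↦ C ^ 2 * ‖x‖ ^ 2)
    (fun k ↦ ((g k).continuous.measurable.mul (g k).continuous.measurable).aestronglyMeasurable)
    (hμ.const_mul _)
    (fun k ↦ ae_of_all _ fun x ↦ by
      have hx : ‖g k x‖ ≤ C * ‖x‖ := (g k).le_of_opNorm_le (hC k) x
      rw [norm_mul, ← sq, ← mul_pow]
      gcongr)
    (ae_of_all _ fun x ↦ by simpa using (hg x).mul (hg x))
  simpa using h

open Filter Topology in
/-- A bounded sequence in the dual of a separable space has a subsequence whose consecutive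
differences converge to `0` pointwise. -/
lemma exists_subseq_sub_tendsto_zero {X : Type*} [NormedAddCommGroup X] [NormedSpace ℝ X]
    [TopologicalSpace.SeparableSpace X] {f : ℕ → X →L[ℝ] ℝ} {C : ℝ} (hf : ∀ n, ‖f n‖ ≤ C) :
    ∃ φ : ℕ → ℕ, StrictMono φ ∧
      ∀ x, Tendsto (fun k ↦ (f (φ (k + 1)) - f (φ k)) x) atTop (𝓝 0) := by
  obtain ⟨a, -, φ, hφ, ha⟩ := WeakDual.isSeqCompact_closedBall ℝ X 0 C
    (x := fun n ↦ StrongDual.toWeakDual (f n)) (fun n ↦ by simpa using hf n)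
  refine ⟨φ, hφ, fun x ↦ ?_⟩
  have hx : Tendsto (fun k ↦ f (φ k) x) atTop (𝓝 (a x)) :=
    ((WeakDual.eval_continuous x).tendsto a).comp ha
  simpa using (hx.comp (tendsto_add_atTop_nat 1)).sub hx

lemma IsCenteredGaussian.isGaussian {X : Type*} [NormedAddCommGroup X] [NormedSpace ℝ X]
    [MeasurableSpace X] [BorelSpace X] {γ : Measure X} (h : IsCenteredGaussian γ) :
    IsGaussian γ :=
  isGaussian_of_map_eq_gaussianReal fun L ↦ ⟨0, h.2 L⟩

/-- the sequence `(λ_n)` is non-increasing and tends to `0`. -/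
theorem scheme_lambda_antitone_tendsto_zero
    {X : Type*} [NormedAddCommGroup X] [NormedSpace ℝ X]
    [CompleteSpace X] [TopologicalSpace.SeparableSpace X]
    [MeasurableSpace X] [BorelSpace X]
    (γ : Measure X) (γs : ℕ → Measure X)
    (Rs : ℕ → (X →L[ℝ] ℝ) →L[ℝ] X) (lam : ℕ → ℝ)
    (fs : ℕ → X →L[ℝ] ℝ) (xs : ℕ → X)
    -- the iterative decomposition scheme:
    (hγ0 : γs 0 = γ)
    (hGauss : ∀ n, IsCenteredGaussian (γs n))
    (hRs : ∀ n (f g : X →L[ℝ] ℝ), g (Rs n f) = ∫ x, f x * g x ∂(γs n))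
    (hsup : ∀ n, IsLUB {c : ℝ | ∃ f : X →L[ℝ] ℝ, ‖f‖ ≤ 1 ∧ c = f (Rs n f)} (lam n))
    (hfs : ∀ n, ‖fs n‖ = 1 ∧ (fs n) (Rs n (fs n)) = lam n)
    (hpos : ∀ n, 0 < lam n)
    (hxs : ∀ n, xs n = (lam n)⁻¹ • Rs n (fs n))
    (hγsucc : ∀ n, γs (n + 1) = (γs n).map (fun x => x - (fs n) x • xs n))
    (hRrec : ∀ n (f : X →L[ℝ] ℝ), Rs (n + 1) f = Rs n f - (lam n * f (xs n)) • xs n)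
    :
    Antitone lam ∧ Filter.Tendsto lam Filter.atTop (nhds 0) := by
  have hsymm (n) (f g : X →L[ℝ] ℝ) : g (Rs n f) = f (Rs n g) := by
    rw [hRs, hRs]; simp only [mul_comm]
  have hstep (n) (f : X →L[ℝ] ℝ) : f (Rs (n + 1) f) ≤ f (Rs n f) := by
    have := mul_nonneg (hpos n).le (mul_self_nonneg (f (xs n)))
    simp only [hRrec, map_sub, map_smul, smul_eq_mul]
    linarith
  have hmono (f : X →L[ℝ] ℝ) : Antitone fun n ↦ f (Rs n f) :=
    antitone_nat_of_succ_le fun n ↦ hstep n f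
  have hanti : Antitone lam := antitone_nat_of_succ_le fun n ↦ by
    rw [← (hfs (n + 1)).2]
    exact (hstep n _).trans ((hsup n).1 ⟨_, (hfs (n + 1)).1.le, rfl⟩)
  have hker (n) : ∀ m, n + 1 ≤ m → Rs m (fs n) = 0 := by
    intro m hm
    induction m, hm using Nat.le_induction with
    | base =>
      have h1 : fs n (xs n) = 1 := by
        rw [hxs, map_smul, (hfs n).2, smul_eq_mul, inv_mul_cancel₀ (hpos n).ne']
      rw [hRrec, h1, hxs, mul_one, smul_inv_smul₀ (hpos n).ne', sub_self]
    | succ m _ ih =>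
      have h0 : fs n (xs m) = 0 := by
        rw [hxs, map_smul, hsymm, ih, map_zero, smul_zero]
      rw [hRrec, ih, h0, mul_zero, zero_smul, sub_zero]
  have hsep {n m} (h : n < m) : lam m ≤ ∫ x, (fs m - fs n) x * (fs m - fs n) x ∂(γs 0) := by
    have hm : (fs m - fs n) (Rs m (fs m - fs n)) = lam m := by
      rw [map_sub, hker n m h, sub_zero, sub_apply, (hfs m).2, hsymm,
        hker n m h, map_zero, sub_zero]
    rw [← hm, ← hRs]
    exact hmono _ (Nat.zero_le m)
  refine ⟨hanti, ?_⟩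
  have := (hGauss 0).isGaussian
  have : SecondCountableTopology X := UniformSpace.secondCountable_of_separable X
  have hmoment : Integrable (fun x : X ↦ ‖x‖ ^ 2) (γs 0) :=
    (IsGaussian.memLp_two_id (μ := γs 0)).integrable_norm_pow (by norm_num)
  obtain ⟨φ, hφ, hlim⟩ := exists_subseq_sub_tendsto_zero fun n ↦ (hfs n).1.le
  have hsq := tendsto_integral_sq_of_forall_tendsto_zero hmoment (C := 2) (fun k ↦ by
    have := norm_sub_le (fs (φ (k + 1))) (fs (φ k))
    rw [(hfs _).1, (hfs _).1] at this
    linarith) hlim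
  refine (tendsto_iff_tendsto_subseq_of_antitone hanti
    (hφ.tendsto_atTop.comp (Filter.tendsto_add_atTop_nat 1))).2 ?_
  exact squeeze_zero (fun k ↦ (hpos _).le) (fun k ↦ hsep (hφ k.lt_succ_self)) hsq
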